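/- (Riesz–Thorin type interpolation for positive operators) Let T₀ be a positive bounded operator on C₀((0,∞), ℝ^N) with norm at most M₀ and T₁ a positive bounded operator on L¹([0,∞), ℝ^N) with norm at most M₁, such that T₀ f = T₁ f for all compactly supported continuous f : (0,∞) → ℝ^N. Then for any 1 < p < ∞, the common restriction of T₀ and T₁ to compactly supported continuous functions extends uniquely to a positive bounded operator T on L^p([0,∞), ℝ^N) with ‖T‖ ≤ M₀^{1−1/p}·M₁^{1/p}. -/

import Mathlib

open MeasureTheory Set ZeroAtInfty ENNReal

/-- Extension by zero of a function on `(0,∞)` to all of `ℝ`. -/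
noncomputable def extZero {E : Type*} [Zero E]
    (f : ↥(Ioi (0:ℝ)) → E) : ℝ → E :=
  fun t => if h : 0 < t then f ⟨t, h⟩ else 0

/-- Scalar Young inequality with a parameter. -/
lemma rtp_young {r s e : ℝ} (hr : 1 < r) (hs : 0 ≤ s) (he : 0 < e) :
    s ≤ (1 - 1 / r) * e + (1 / r) * (e ^ (1 - r) * s ^ r) := by
  have hr0 : 0 < r := by linarith
  have h1 : 1 / r ≤ 1 := by rw [div_le_one hr0]; exact hr.le
  have h := Real.geom_mean_le_arith_mean2_weighted (w₁ := 1 - 1 / r) (w₂ := 1 / r)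
    (p₁ := e) (p₂ := e ^ (1 - r) * s ^ r) (by linarith) (by positivity) he.le
    (by positivity) (by ring)
  refine le_trans (le_of_eq ?_) h
  rw [Real.mul_rpow (by positivity) (by positivity), ← Real.rpow_mul he.le, ← Real.rpow_mul hs,
    ← mul_assoc, ← Real.rpow_add he]
  have e1 : 1 - 1 / r + (1 - r) * (1 / r) = 0 := by field_simp; ring
  have e2 : r * (1 / r) = 1 := by field_simp
  rw [e1, e2]; simp

lemma rtp_opt {r a M V : ℝ} (hr : 1 < r) (ha : 0 ≤ a) (hM : 0 ≤ M) (hV : 0 ≤ V)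
    (h : ∀ e : ℝ, 0 < e → a ≤ (1 - 1 / r) * (e * M) + (1 / r) * (e ^ (1 - r) * V)) :
    a ^ r ≤ M ^ (r - 1) * V := by
  have hr0 : 0 < r := by linarith
  have h1 : 1 / r ≤ 1 := by rw [div_le_one hr0]; exact hr.le
  have key : ∀ d : ℝ, 0 < d → a ^ r ≤ (M + d) ^ (r - 1) * (V + d) := by
    intro d hd
    have hM' : 0 < M + d := by linarith
    have hV' : 0 < V + d := by linarith
    set A := M + d
    set B := V + d
    have hAB : 0 < B / A := by positivity
    have h2 := h ((B / A) ^ (1 / r)) (by positivity)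
    have h3 : a ≤ (1 - 1 / r) * ((B / A) ^ (1 / r) * A)
        + (1 / r) * (((B / A) ^ (1 / r)) ^ (1 - r) * B) := by
      refine h2.trans ?_
      have : 0 ≤ 1 - 1 / r := by linarith
      gcongr
      · simp only [A]; linarith
      · simp only [B]; linarith
    have h4 : ((B / A) ^ (1 / r)) ^ (1 - r) * B = (B / A) ^ (1 / r) * A := by
      rw [← Real.rpow_mul hAB.le]
      have : 1 / r * (1 - r) = 1 / r - 1 := by field_simp
      rw [this, Real.rpow_sub_one hAB.ne']
      field_simp
    rw [h4] at h3
    have h5 : a ≤ (B / A) ^ (1 / r) * A := by linarith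
    calc a ^ r ≤ ((B / A) ^ (1 / r) * A) ^ r := by gcongr
      _ = (B / A) * A ^ r := by
        rw [Real.mul_rpow (by positivity) hM'.le, ← Real.rpow_mul hAB.le]
        have e2 : 1 / r * r = 1 := by field_simp
        rw [e2, Real.rpow_one]
      _ = A ^ (r - 1) * B := by
        rw [Real.rpow_sub_one hM'.ne']; field_simp
  have hc : Filter.Tendsto (fun d : ℝ => (M + d) ^ (r - 1) * (V + d)) (nhdsWithin 0 (Ioi 0))
      (nhds (M ^ (r - 1) * V)) := by
    have : Continuous (fun d : ℝ => (M + d) ^ (r - 1) * (V + d)) := by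
      refine Continuous.mul ?_ (by fun_prop)
      exact (continuous_const.add continuous_id).rpow_const (fun _ => Or.inr (by linarith))
    have h0 := this.tendsto 0
    simp only [add_zero] at h0
    exact h0.mono_left nhdsWithin_le_nhds
  refine ge_of_tendsto hc ?_
  filter_upwards [self_mem_nhdsWithin] with d hd using key d hd

lemma rtp_solid (N : ℕ) : HasSolidNorm (Fin N → ℝ) := ⟨by
  intro x y hxy
  rw [pi_norm_le_iff_of_nonneg (norm_nonneg _)]
  intro i
  refine le_trans ?_ (norm_le_pi_norm y i)
  exact hxy i⟩

lemma rtp_mp : MeasurePreserving (Subtype.val : ↥(Ioi (0:ℝ)) → ℝ)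
    (Measure.comap Subtype.val volume) ((volume : Measure ℝ).restrict (Ici 0)) := by
  rw [← restrict_Ioi_eq_restrict_Ici]
  exact measurePreserving_subtype_coe measurableSet_Ioi

lemma rtp_ext_comp {E : Type*} [Zero E] (f : ↥(Ioi (0:ℝ)) → E) :
    extZero f ∘ Subtype.val = f := by
  funext x
  have : 0 < x.1 := x.2
  simp [extZero, this]

lemma rtp_ext_meas {N : ℕ} {f : ↥(Ioi (0:ℝ)) → Fin N → ℝ} (hf : Continuous f) :
    AEStronglyMeasurable (extZero f) ((volume : Measure ℝ).restrict (Ici 0)) := by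
  have : Measurable (extZero f) := by
    unfold extZero
    exact Measurable.dite (s := {t : ℝ | 0 < t}) (hf.measurable) measurable_const measurableSet_Ioi
  exact this.aestronglyMeasurable

lemma rtp_ext_add {N : ℕ} (f g : ↥(Ioi (0:ℝ)) → Fin N → ℝ) :
    extZero (f + g) = extZero f + extZero g := by
  funext t
  by_cases h : 0 < t <;> simp [extZero, h]

lemma rtp_ext_smul {N : ℕ} (c : ℝ) (f : ↥(Ioi (0:ℝ)) → Fin N → ℝ) :
    extZero (c • f) = c • extZero f := by
  funext t
  by_cases h : 0 < t <;> simp [extZero, h]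

lemma rtp_ext_memLp {N : ℕ} {f : ↥(Ioi (0:ℝ)) → Fin N → ℝ} (hf : Continuous f)
    (hc : HasCompactSupport f) (p : ℝ≥0∞) :
    MemLp (extZero f) p ((volume : Measure ℝ).restrict (Ici 0)) := by
  have hK : IsCompact (Subtype.val '' tsupport f : Set ℝ) := hc.isCompact.image continuous_subtype_val
  obtain ⟨C, hC⟩ := hc.exists_bound_of_continuous hf
  have h2 : MemLp ((Subtype.val '' tsupport f).indicator (extZero f)) p
      ((volume : Measure ℝ).restrict (Ici 0)) := by
    rw [memLp_indicator_iff_restrict hK.measurableSet]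
    have : IsFiniteMeasure (((volume : Measure ℝ).restrict (Ici 0)).restrict
      (Subtype.val '' tsupport f)) := ⟨by
        rw [Measure.restrict_apply_univ]
        exact hK.measure_lt_top⟩
    refine MemLp.of_bound (rtp_ext_meas hf).restrict (max C 0) (Filter.Eventually.of_forall ?_)
    intro t
    by_cases h : 0 < t
    · simp only [extZero, h, dif_pos]; exact (hC _).trans (le_max_left _ _)
    · simp [extZero, h]
  convert h2 using 1
  symm
  rw [indicator_eq_self]
  intro t ht
  by_cases h : 0 < t
  · refine ⟨⟨t, h⟩, subset_tsupport _ ?_, rfl⟩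
    simpa [extZero, h] using ht
  · simp [extZero, h] at ht

/-- The C₀ function given by a compactly supported continuous function. -/
def rtpMk {N : ℕ} (f : ↥(Ioi (0:ℝ)) → Fin N → ℝ) (hf : Continuous f)
    (hc : HasCompactSupport f) : C₀(↥(Ioi (0:ℝ)), Fin N → ℝ) :=
  ⟨⟨f, hf⟩, hc.is_zero_at_infty⟩

lemma rtp_lc : LocallyCompactSpace ↥(Ioi (0:ℝ)) := isOpen_Ioi.locallyCompactSpace

lemma rtp_dense {N : ℕ} {p : ℝ≥0∞} (hp' : p ≠ ⊤) {g : ℝ → Fin N → ℝ}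
    (hg : MemLp g p ((volume : Measure ℝ).restrict (Ici 0))) {e : ℝ≥0∞} (he : e ≠ 0) :
    ∃ f : ↥(Ioi (0:ℝ)) → Fin N → ℝ, Continuous f ∧ HasCompactSupport f ∧
      eLpNorm (g - extZero f) p ((volume : Measure ℝ).restrict (Ici 0)) ≤ e := by
  have := rtp_lc
  have : SecondCountableTopology ↥(Ioi (0:ℝ)) := inferInstance
  have : SigmaCompactSpace ↥(Ioi (0:ℝ)) := inferInstance
  have : IsLocallyFiniteMeasure
      (Measure.comap (Subtype.val : ↥(Ioi (0:ℝ)) → ℝ) volume) := by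
    refine ⟨fun x => ?_⟩
    obtain ⟨s, hs, hfin⟩ := (volume : Measure ℝ).finiteAt_nhds x.1
    refine ⟨Subtype.val ⁻¹' s, continuous_subtype_val.continuousAt hs, ?_⟩
    rw [comap_subtype_coe_apply measurableSet_Ioi]
    exact (measure_mono (image_preimage_subset _ _)).trans_lt hfin
  have : (Measure.comap (Subtype.val : ↥(Ioi (0:ℝ)) → ℝ) volume).Regular := inferInstance
  have h1 : MemLp (g ∘ Subtype.val) p (Measure.comap (Subtype.val : ↥(Ioi (0:ℝ)) → ℝ) volume) :=
    hg.comp_measurePreserving rtp_mp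
  obtain ⟨f, hfc, hfe, hf, -⟩ := h1.exists_hasCompactSupport_eLpNorm_sub_le hp' he
  refine ⟨f, hf, hfc, ?_⟩
  rw [← eLpNorm_comp_measurePreserving (hg.1.sub (rtp_ext_meas hf)) rtp_mp]
  convert hfe using 2
  conv_rhs => rw [← rtp_ext_comp f]
  rfl

/-- Pointwise estimate. -/
lemma rtp_pointwise {N : ℕ}
    (T₀ : C₀(↥(Ioi (0:ℝ)), Fin N → ℝ) →L[ℝ] C₀(↥(Ioi (0:ℝ)), Fin N → ℝ))
    (M₀ : ℝ) (hM₀ : ‖T₀‖ ≤ M₀)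
    (hT₀pos : ∀ f : C₀(↥(Ioi (0:ℝ)), Fin N → ℝ),
      (∀ x, 0 ≤ f x) → ∀ x, 0 ≤ (T₀ f) x)
    {r : ℝ} (hr : 1 < r) (f W : C₀(↥(Ioi (0:ℝ)), Fin N → ℝ))
    (hc : HasCompactSupport (fun x : ↥(Ioi (0:ℝ)) => f x))
    (hW : ∀ x i, W x i = ‖f x‖ ^ r) (x : ↥(Ioi (0:ℝ))) :
    ‖T₀ f x‖ ^ r ≤ M₀ ^ (r - 1) * ‖T₀ W x‖ := by
  have := rtp_lc
  have hM0 : 0 ≤ M₀ := (norm_nonneg T₀).trans hM₀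
  have hr1 : 0 ≤ 1 - 1 / r := by
    have : 1 / r ≤ 1 := by rw [div_le_one (by linarith)]; exact hr.le
    linarith
  obtain ⟨k, hk1, -, hkc, hk01⟩ := exists_continuous_one_zero_of_isCompact
    (X := ↥(Ioi (0:ℝ))) hc.isCompact isClosed_empty (disjoint_empty _)
  have hXc : HasCompactSupport (fun x : ↥(Ioi (0:ℝ)) => (fun _ : Fin N => k x)) :=
    hkc.comp_left (g := fun (t : ℝ) => (fun _ : Fin N => t)) rfl
  set X : C₀(↥(Ioi (0:ℝ)), Fin N → ℝ) :=
    rtpMk (fun x => fun _ => k x) (by fun_prop) hXc with hX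
  have hXx : ∀ x i, X x i = k x := fun _ _ => rfl
  have hXn : ‖X‖ ≤ 1 := by
    rw [← ZeroAtInftyContinuousMap.norm_toBCF_eq_norm]
    rw [BoundedContinuousFunction.norm_le zero_le_one]
    intro y
    rw [pi_norm_le_iff_of_nonneg zero_le_one]
    intro i
    change ‖k y‖ ≤ 1
    rw [Real.norm_eq_abs, abs_le]
    have := hk01 y
    constructor <;> linarith [this.1, this.2]
  have hTX : ‖T₀ X x‖ ≤ M₀ := by
    calc ‖T₀ X x‖ ≤ ‖T₀ X‖ := by
          rw [← ZeroAtInftyContinuousMap.norm_toBCF_eq_norm]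
          exact (T₀ X).toBCF.norm_coe_le_norm x
      _ ≤ ‖T₀‖ * ‖X‖ := T₀.le_opNorm X
      _ ≤ M₀ * 1 := by gcongr
      _ = M₀ := mul_one _
  refine rtp_opt hr (norm_nonneg _) hM0 (norm_nonneg _) ?_
  intro e he
  set G : C₀(↥(Ioi (0:ℝ)), Fin N → ℝ) :=
    ((1 - 1 / r) * e) • X + ((1 / r) * e ^ (1 - r)) • W with hG
  have hdom : ∀ y i, |f y i| ≤ G y i := by
    intro y i
    have hGy : G y i = ((1 - 1 / r) * e) * k y + ((1 / r) * e ^ (1 - r)) * ‖f y‖ ^ r := by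
      simp [hG, hXx, hW]
    rw [hGy]
    have hle : |f y i| ≤ ‖f y‖ := norm_le_pi_norm (f y) i
    by_cases hy : y ∈ tsupport (fun x : ↥(Ioi (0:ℝ)) => f x)
    · have : k y = 1 := hk1 hy
      rw [this]
      have := rtp_young hr (norm_nonneg (f y)) he
      nlinarith
    · have : f y = 0 := image_eq_zero_of_notMem_tsupport hy
      have h0 := (hk01 y).1
      have he' : 0 < e ^ (1 - r) := by positivity
      rw [this]
      simp only [Pi.zero_apply, abs_zero]
      positivity
  have hp1 := hT₀pos (G - f) (fun y i => by
    have := le_of_abs_le (hdom y i)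
    simpa using this) x
  have hp2 := hT₀pos (G + f) (fun y i => by
    have := neg_le_of_abs_le (hdom y i)
    simp only [ZeroAtInftyContinuousMap.add_apply, Pi.add_apply, Pi.zero_apply]
    linarith) x
  have hGn : ∀ i, T₀ G x i ≤ (1 - 1 / r) * (e * M₀) + (1 / r) * (e ^ (1 - r) * ‖T₀ W x‖) := by
    intro i
    have h1 : T₀ G x i = ((1 - 1 / r) * e) * T₀ X x i + ((1 / r) * e ^ (1 - r)) * T₀ W x i := by
      simp [hG, map_add, map_smul]
    rw [h1, ← mul_assoc, ← mul_assoc]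
    have h2 : T₀ X x i ≤ M₀ := (le_abs_self _).trans ((norm_le_pi_norm (T₀ X x) i).trans hTX)
    have h3 : T₀ W x i ≤ ‖T₀ W x‖ := (le_abs_self _).trans (norm_le_pi_norm (T₀ W x) i)
    have he' : 0 < e ^ (1 - r) := by positivity
    gcongr
  rw [pi_norm_le_iff_of_nonneg (by positivity)]
  intro i
  refine le_trans ?_ (hGn i)
  rw [Real.norm_eq_abs, abs_le]
  have a1 := hp1 i
  have a2 := hp2 i
  rw [map_sub] at a1
  rw [map_add] at a2
  simp only [ZeroAtInftyContinuousMap.add_apply, ZeroAtInftyContinuousMap.sub_apply,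
    Pi.add_apply, Pi.sub_apply, Pi.zero_apply] at a1 a2
  constructor <;> linarith

lemma rtp_bound {N : ℕ}
    (T₀ : C₀(↥(Ioi (0:ℝ)), Fin N → ℝ) →L[ℝ] C₀(↥(Ioi (0:ℝ)), Fin N → ℝ))
    (T₁ : Lp (α := ℝ) (Fin N → ℝ) 1 ((volume : Measure ℝ).restrict (Ici 0)) →L[ℝ]
          Lp (α := ℝ) (Fin N → ℝ) 1 ((volume : Measure ℝ).restrict (Ici 0)))
    (M₀ M₁ : ℝ)
    (hM₀ : ‖T₀‖ ≤ M₀) (hM₁ : ‖T₁‖ ≤ M₁)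
    (hT₀pos : ∀ f : C₀(↥(Ioi (0:ℝ)), Fin N → ℝ),
      (∀ x, 0 ≤ f x) → ∀ x, 0 ≤ (T₀ f) x)
    (hagree : ∀ (f : C₀(↥(Ioi (0:ℝ)), Fin N → ℝ))
        (g : Lp (α := ℝ) (Fin N → ℝ) 1 ((volume : Measure ℝ).restrict (Ici 0))),
      HasCompactSupport (fun x : ↥(Ioi (0:ℝ)) => f x) →
      (⇑g =ᵐ[(volume : Measure ℝ).restrict (Ici 0)] extZero ⇑f) →
      ⇑(T₁ g) =ᵐ[(volume : Measure ℝ).restrict (Ici 0)] extZero ⇑(T₀ f))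
    (p : ℝ≥0∞) (hp : 1 < p) (hp' : p ≠ ⊤) (f : C₀(↥(Ioi (0:ℝ)), Fin N → ℝ))
    (hc : HasCompactSupport (fun x : ↥(Ioi (0:ℝ)) => f x)) :
    eLpNorm (extZero ⇑(T₀ f)) p ((volume : Measure ℝ).restrict (Ici 0)) ≤
      ENNReal.ofReal (M₀ ^ (1 - 1 / p.toReal) * M₁ ^ (1 / p.toReal)) *
        eLpNorm (extZero ⇑f) p ((volume : Measure ℝ).restrict (Ici 0)) := by
  have hM0 : 0 ≤ M₀ := (norm_nonneg T₀).trans hM₀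
  have hM1 : 0 ≤ M₁ := (norm_nonneg T₁).trans hM₁
  set r := p.toReal with hrdef
  have hr : 1 < r := by
    have := (ENNReal.toReal_lt_toReal (by simp) hp').2 hp
    simpa using this
  have hr0 : 0 < r := by linarith
  have hp0 : p ≠ 0 := by rintro rfl; simp at hp
  have hWcont : Continuous (fun x : ↥(Ioi (0:ℝ)) => (fun _ : Fin N => ‖f x‖ ^ r)) := by
    refine continuous_pi fun _ => ?_
    exact (map_continuous f).norm.rpow_const (fun _ => Or.inr hr0.le)
  have hWc : HasCompactSupport (fun x : ↥(Ioi (0:ℝ)) => (fun _ : Fin N => ‖f x‖ ^ r)) :=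
    hc.comp_left (g := fun (t : Fin N → ℝ) => (fun _ : Fin N => ‖t‖ ^ r))
      (by funext i; simp [Real.zero_rpow hr0.ne'])
  set W : C₀(↥(Ioi (0:ℝ)), Fin N → ℝ) := rtpMk _ hWcont hWc with hW
  have hpt := rtp_pointwise T₀ M₀ hM₀ hT₀pos hr f W hc (fun _ _ => rfl)
  have hWmem : MemLp (extZero ⇑W) 1 ((volume : Measure ℝ).restrict (Ici 0)) := rtp_ext_memLp hWcont hWc 1
  have hag := hagree W hWmem.toLp hWc hWmem.coeFn_toLp
  have hTw : ‖T₁ hWmem.toLp‖ ≤ M₁ * ‖hWmem.toLp‖ := T₁.le_of_opNorm_le hM₁ hWmem.toLp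
  -- the L¹ estimate
  have h1 : ∫⁻ t, ‖extZero ⇑(T₀ W) t‖ₑ ∂((volume : Measure ℝ).restrict (Ici 0)) ≤ ENNReal.ofReal M₁ * ∫⁻ t, ‖extZero ⇑W t‖ₑ ∂((volume : Measure ℝ).restrict (Ici 0)) := by
    rw [← eLpNorm_one_eq_lintegral_enorm, ← eLpNorm_one_eq_lintegral_enorm,
      ← eLpNorm_congr_ae hag, ← eLpNorm_congr_ae hWmem.coeFn_toLp, ← Lp.enorm_def, ← Lp.enorm_def]
    rw [← ofReal_norm, ← ofReal_norm, ← ENNReal.ofReal_mul hM1]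
    exact ENNReal.ofReal_le_ofReal hTw
  have h2 : ∀ t, ‖extZero ⇑W t‖ₑ ≤ ‖extZero ⇑f t‖ₑ ^ r := by
    intro t
    by_cases ht : 0 < t
    · simp only [extZero, ht, dif_pos]
      rw [← ofReal_norm, ← ofReal_norm,
        ENNReal.ofReal_rpow_of_nonneg (norm_nonneg _) hr0.le]
      refine ENNReal.ofReal_le_ofReal ?_
      refine (pi_norm_const_le (‖f ⟨t, ht⟩‖ ^ r)).trans (le_of_eq ?_)
      rw [Real.norm_of_nonneg (by positivity)]
    · simp [extZero, ht]
  have h3 : ∀ t, ‖extZero ⇑(T₀ f) t‖ₑ ^ r ≤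
      ENNReal.ofReal (M₀ ^ (r - 1)) * ‖extZero ⇑(T₀ W) t‖ₑ := by
    intro t
    by_cases ht : 0 < t
    · simp only [extZero, ht, dif_pos]
      rw [← ofReal_norm, ← ofReal_norm,
        ENNReal.ofReal_rpow_of_nonneg (norm_nonneg _) hr0.le,
        ← ENNReal.ofReal_mul (by positivity)]
      exact ENNReal.ofReal_le_ofReal (hpt _)
    · simp [extZero, ht, hr0]
  have h4 : ∫⁻ t, ‖extZero ⇑(T₀ f) t‖ₑ ^ r ∂((volume : Measure ℝ).restrict (Ici 0)) ≤
      ENNReal.ofReal (M₀ ^ (r - 1) * M₁) * ∫⁻ t, ‖extZero ⇑f t‖ₑ ^ r ∂((volume : Measure ℝ).restrict (Ici 0)) := by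
    calc ∫⁻ t, ‖extZero ⇑(T₀ f) t‖ₑ ^ r ∂((volume : Measure ℝ).restrict (Ici 0))
        ≤ ∫⁻ t, ENNReal.ofReal (M₀ ^ (r - 1)) * ‖extZero ⇑(T₀ W) t‖ₑ ∂((volume : Measure ℝ).restrict (Ici 0)) := lintegral_mono h3
      _ = ENNReal.ofReal (M₀ ^ (r - 1)) * ∫⁻ t, ‖extZero ⇑(T₀ W) t‖ₑ ∂((volume : Measure ℝ).restrict (Ici 0)) :=
          lintegral_const_mul' _ _ ENNReal.ofReal_ne_top
      _ ≤ ENNReal.ofReal (M₀ ^ (r - 1)) * (ENNReal.ofReal M₁ * ∫⁻ t, ‖extZero ⇑W t‖ₑ ∂((volume : Measure ℝ).restrict (Ici 0))) := by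
          gcongr
      _ ≤ ENNReal.ofReal (M₀ ^ (r - 1)) *
            (ENNReal.ofReal M₁ * ∫⁻ t, ‖extZero ⇑f t‖ₑ ^ r ∂((volume : Measure ℝ).restrict (Ici 0))) := by
          gcongr with t
          exact h2 t
      _ = _ := by rw [← mul_assoc, ← ENNReal.ofReal_mul (by positivity)]
  rw [eLpNorm_eq_lintegral_rpow_enorm_toReal hp0 hp', eLpNorm_eq_lintegral_rpow_enorm_toReal hp0 hp',
    ← hrdef]
  refine (ENNReal.rpow_le_rpow h4 (by positivity)).trans (le_of_eq ?_)
  rw [ENNReal.mul_rpow_of_nonneg _ _ (by positivity),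
    ENNReal.ofReal_rpow_of_nonneg (by positivity) (by positivity),
    Real.mul_rpow (by positivity) hM1, ← Real.rpow_mul hM0]
  have : (r - 1) * (1 / r) = 1 - 1 / r := by field_simp
  rw [this]

/-- Compactly supported continuous functions. -/
def rtpSub (N : ℕ) : Submodule ℝ (↥(Ioi (0:ℝ)) → Fin N → ℝ) where
  carrier := {f | Continuous f ∧ HasCompactSupport f}
  add_mem' := fun {_ _} ha hb => ⟨ha.1.add hb.1, ha.2.add hb.2⟩
  zero_mem' := ⟨continuous_zero, HasCompactSupport.zero⟩
  smul_mem' := fun c f hf => ⟨hf.1.const_smul c,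
    hf.2.comp_left (g := fun t : Fin N → ℝ => c • t) (smul_zero c)⟩

/-- The C₀ function of an element of `rtpSub`. -/
def rtpTo {N : ℕ} (f : rtpSub N) : C₀(↥(Ioi (0:ℝ)), Fin N → ℝ) := rtpMk f.1 f.2.1 f.2.2

lemma rtpTo_add {N : ℕ} (f g : rtpSub N) : rtpTo (f + g) = rtpTo f + rtpTo g := by
  ext x; rfl

lemma rtpTo_smul {N : ℕ} (c : ℝ) (f : rtpSub N) : rtpTo (c • f) = c • rtpTo f := by
  ext x; rfl

lemma rtp_extend {E F G : Type*} [AddCommGroup E] [Module ℝ E] [NormedAddCommGroup F]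
    [NormedSpace ℝ F] [NormedAddCommGroup G] [NormedSpace ℝ G] [CompleteSpace G]
    (S : E →ₗ[ℝ] G) (e : E →ₗ[ℝ] F) (hd : DenseRange e) {K : ℝ} (hK : 0 ≤ K)
    (h : ∀ x, ‖S x‖ ≤ K * ‖e x‖) :
    ∃ T : F →L[ℝ] G, (∀ x, T (e x) = S x) ∧ ‖T‖ ≤ K ∧
      ∀ T' : F →L[ℝ] G, (∀ x, T' (e x) = S x) → T' = T :=
  ⟨S.extendOfNorm e, LinearMap.extendOfNorm_eq hd ⟨K, h⟩,
    LinearMap.opNorm_extendOfNorm_le hd hK h, fun T' hT' =>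
      (LinearMap.extendOfNorm_unique hd K h T' (LinearMap.ext hT')).symm⟩

/-- (Riesz–Thorin type interpolation for positive operators) Let `T₀` be a
positive bounded operator on `C₀((0,∞), ℝ^N)` with norm at most `M₀` and `T₁`
a positive bounded operator on `L¹([0,∞), ℝ^N)` with norm at most `M₁`,
agreeing on compactly supported continuous functions.  Then for any
`1 < p < ∞` the common restriction extends uniquely to a positive bounded
operator `T` on `L^p([0,∞), ℝ^N)` with `‖T‖ ≤ M₀^{1−1/p} M₁^{1/p}`. -/
theorem riesz_thorin_positive {N : ℕ}
    (T₀ : C₀(↥(Ioi (0:ℝ)), Fin N → ℝ) →L[ℝ] C₀(↥(Ioi (0:ℝ)), Fin N → ℝ))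
    (T₁ : Lp (α := ℝ) (Fin N → ℝ) 1 ((volume : Measure ℝ).restrict (Ici 0)) →L[ℝ]
          Lp (α := ℝ) (Fin N → ℝ) 1 ((volume : Measure ℝ).restrict (Ici 0)))
    (M₀ M₁ : ℝ)
    (hM₀ : ‖T₀‖ ≤ M₀) (hM₁ : ‖T₁‖ ≤ M₁)
    (hT₀pos : ∀ f : C₀(↥(Ioi (0:ℝ)), Fin N → ℝ),
      (∀ x, 0 ≤ f x) → ∀ x, 0 ≤ (T₀ f) x)
    (hT₁pos : ∀ g, (∀ᵐ t ∂((volume : Measure ℝ).restrict (Ici 0)), 0 ≤ g t) →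
      ∀ᵐ t ∂((volume : Measure ℝ).restrict (Ici 0)), 0 ≤ (T₁ g) t)
    (hagree : ∀ (f : C₀(↥(Ioi (0:ℝ)), Fin N → ℝ))
        (g : Lp (α := ℝ) (Fin N → ℝ) 1 ((volume : Measure ℝ).restrict (Ici 0))),
      HasCompactSupport (fun x : ↥(Ioi (0:ℝ)) => f x) →
      (⇑g =ᵐ[(volume : Measure ℝ).restrict (Ici 0)] extZero ⇑f) →
      ⇑(T₁ g) =ᵐ[(volume : Measure ℝ).restrict (Ici 0)] extZero ⇑(T₀ f))
    (p : ℝ≥0∞) [Fact (1 ≤ p)] (hp : 1 < p) (hp' : p ≠ ⊤) :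
    ∃! T : Lp (α := ℝ) (Fin N → ℝ) p ((volume : Measure ℝ).restrict (Ici 0)) →L[ℝ]
           Lp (α := ℝ) (Fin N → ℝ) p ((volume : Measure ℝ).restrict (Ici 0)),
      (∀ g, (∀ᵐ t ∂((volume : Measure ℝ).restrict (Ici 0)), 0 ≤ g t) →
        ∀ᵐ t ∂((volume : Measure ℝ).restrict (Ici 0)), 0 ≤ (T g) t) ∧
      (∀ (f : C₀(↥(Ioi (0:ℝ)), Fin N → ℝ))
          (g : Lp (α := ℝ) (Fin N → ℝ) p ((volume : Measure ℝ).restrict (Ici 0))),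
        HasCompactSupport (fun x : ↥(Ioi (0:ℝ)) => f x) →
        (⇑g =ᵐ[(volume : Measure ℝ).restrict (Ici 0)] extZero ⇑f) →
        ⇑(T g) =ᵐ[(volume : Measure ℝ).restrict (Ici 0)] extZero ⇑(T₀ f)) ∧
      ‖T‖ ≤ M₀ ^ (1 - 1 / p.toReal) * M₁ ^ (1 / p.toReal) := by
  have hb := rtp_bound T₀ T₁ M₀ M₁ hM₀ hM₁ hT₀pos hagree p hp hp'
  have hM0 : 0 ≤ M₀ := (norm_nonneg T₀).trans hM₀
  have hM1 : 0 ≤ M₁ := (norm_nonneg T₁).trans hM₁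
  set K := M₀ ^ (1 - 1 / p.toReal) * M₁ ^ (1 / p.toReal) with hK
  have hK0 : 0 ≤ K := by positivity
  have hmem : ∀ f : rtpSub N, MemLp (extZero f.1) p ((volume : Measure ℝ).restrict (Ici 0)) :=
    fun f => rtp_ext_memLp f.2.1 f.2.2 p
  have hmemT : ∀ f : rtpSub N,
      MemLp (extZero ⇑(T₀ (rtpTo f))) p ((volume : Measure ℝ).restrict (Ici 0)) :=
    fun f => ⟨rtp_ext_meas (map_continuous _), (hb (rtpTo f) f.2.2).trans_lt
      (ENNReal.mul_lt_top ENNReal.ofReal_lt_top (hmem f).2)⟩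
  obtain ⟨e, he⟩ : ∃ e : rtpSub N →ₗ[ℝ] Lp (α := ℝ) (Fin N → ℝ) p ((volume : Measure ℝ).restrict (Ici 0)),
      ∀ f, e f = (hmem f).toLp :=
    ⟨{
      toFun := fun f => (hmem f).toLp
      map_add' := fun f g => by
        rw [← MemLp.toLp_add]
        exact MemLp.toLp_congr _ _ (Filter.EventuallyEq.of_eq (rtp_ext_add _ _))
      map_smul' := fun c f => by
        rw [RingHom.id_apply, ← MemLp.toLp_const_smul]
        exact MemLp.toLp_congr _ _ (Filter.EventuallyEq.of_eq (rtp_ext_smul _ _)) }, fun _ => rfl⟩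
  obtain ⟨S, hS⟩ : ∃ S : rtpSub N →ₗ[ℝ] Lp (α := ℝ) (Fin N → ℝ) p ((volume : Measure ℝ).restrict (Ici 0)),
      ∀ f, S f = (hmemT f).toLp :=
    ⟨{
      toFun := fun f => (hmemT f).toLp
      map_add' := fun f g => by
        rw [← MemLp.toLp_add]
        refine MemLp.toLp_congr _ _ (Filter.EventuallyEq.of_eq ?_)
        rw [← rtp_ext_add, rtpTo_add, map_add]
        rfl
      map_smul' := fun c f => by
        rw [RingHom.id_apply, ← MemLp.toLp_const_smul]
        refine MemLp.toLp_congr _ _ (Filter.EventuallyEq.of_eq ?_)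
        rw [← rtp_ext_smul, rtpTo_smul, map_smul]
        rfl }, fun _ => rfl⟩
  have heS : ∀ f : rtpSub N, ‖S f‖ ≤ K * ‖e f‖ := by
    intro f
    rw [hS, he, Lp.norm_toLp, Lp.norm_toLp]
    have h1 := ENNReal.toReal_mono
      (ENNReal.mul_lt_top ENNReal.ofReal_lt_top (hmem f).2).ne (hb (rtpTo f) f.2.2)
    rwa [ENNReal.toReal_mul, ENNReal.toReal_ofReal hK0] at h1
  have hdense : DenseRange e := by
    intro g
    rw [Metric.mem_closure_iff]
    intro d hd
    obtain ⟨f, hf, hfc, hfe⟩ := rtp_dense hp' (Lp.memLp g) (e := ENNReal.ofReal (d / 2))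
      (by simpa using hd)
    refine ⟨_, ⟨⟨f, hf, hfc⟩, rfl⟩, ?_⟩
    rw [dist_eq_norm]
    have h2 : g - e ⟨f, hf, hfc⟩ =
        ((Lp.memLp g).sub (hmem ⟨f, hf, hfc⟩)).toLp := by
      rw [MemLp.toLp_sub (Lp.memLp g) (hmem ⟨f, hf, hfc⟩), Lp.toLp_coeFn, he]
    rw [h2, Lp.norm_toLp]
    have h3 := ENNReal.toReal_mono ENNReal.ofReal_ne_top hfe
    rw [ENNReal.toReal_ofReal (by positivity)] at h3
    refine lt_of_le_of_lt h3 (by linarith)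
  obtain ⟨T, hext, hTn, huniq⟩ := rtp_extend S e hdense hK0 heS
  refine ⟨T, ⟨?_, ?_, hTn⟩, ?_⟩
  · have := rtp_solid N
    intro g hg
    have hg' : 0 ≤ g := (Lp.coeFn_nonneg g).1 hg
    refine (Lp.coeFn_nonneg _).2 ?_
    have hall : ∀ g : Lp (α := ℝ) (Fin N → ℝ) p ((volume : Measure ℝ).restrict (Ici 0)),
        0 ≤ T (g ⊔ 0) := by
      intro g
      refine hdense.induction_on (p := fun g => 0 ≤ T (g ⊔ 0)) g ?_ ?_
      · exact isClosed_le continuous_const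
          (T.continuous.comp (continuous_id.sup continuous_const))
      · intro f
        have hfc : HasCompactSupport (fun x : ↥(Ioi (0:ℝ)) => f.1 x ⊔ 0) :=
          HasCompactSupport.comp_left (g := fun t : Fin N → ℝ => t ⊔ 0) f.2.2 (sup_idem 0)
        have hfcont : Continuous (fun x : ↥(Ioi (0:ℝ)) => f.1 x ⊔ 0) :=
          f.2.1.sup continuous_const
        have h1 : e f ⊔ 0 = e ⟨_, hfcont, hfc⟩ := by
          rw [he, he]
          refine Lp.ext ?_
          filter_upwards [Lp.coeFn_sup (hmem f).toLp 0, (hmem f).coeFn_toLp,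
            (hmem ⟨_, hfcont, hfc⟩).coeFn_toLp,
            Lp.coeFn_zero (Fin N → ℝ) p ((volume : Measure ℝ).restrict (Ici 0))] with t h1 h2 h3 h4
          rw [h1]
          rw [h3, Pi.sup_apply, h4, h2]
          by_cases ht : 0 < t
          · simp only [extZero, ht, dif_pos]; rfl
          · simp [extZero, ht]
        rw [h1, hext, hS]
        refine (Lp.coeFn_nonneg _).1 ?_
        filter_upwards [(hmemT ⟨_, hfcont, hfc⟩).coeFn_toLp] with t ht
        refine le_of_le_of_eq ?_ ht.symm
        by_cases h : 0 < t
        · simp only [extZero, h, dif_pos]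
          exact hT₀pos (rtpMk _ hfcont hfc) (fun x => le_sup_right) _
        · simp [extZero, h]
    have := hall g
    rwa [sup_eq_left.2 hg'] at this
  · intro f g hc hg
    have h1 : g = e ⟨⇑f, map_continuous f, hc⟩ := by
      rw [he]
      exact Lp.ext (hg.trans (hmem ⟨⇑f, map_continuous f, hc⟩).coeFn_toLp.symm)
    rw [h1, hext, hS]
    exact (hmemT ⟨⇑f, map_continuous f, hc⟩).coeFn_toLp
  · rintro T' ⟨-, hT', -⟩
    refine huniq T' fun f => Lp.ext ?_
    rw [hS]
    refine (hT' (rtpTo f) (e f) f.2.2 ?_).trans (hmemT f).coeFn_toLp.symm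
    rw [he]
    exact (hmem f).coeFn_toLp
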